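/- Fix a natural number n, an index i : Fin n, and a value v with v ≤ n - 1 - i. Then card{π : permutation of Fin n | f_π(i) = v} · (n - i) = n!, where f_π(i) = card{j : Fin n | i < j ∧ π(j) < π(i)} is the i-th Lehmer code digit of π. That is, when permutations of Fin n are distributed uniformly, each factoradic digit f(i) is uniformly distributed over its range {0, 1, ..., n - i - 1}. -/

import Mathlib

open Finset

/-- Among the values of an injective function on a finite set `s`, every rank `v < #s` is attained
at exactly one point. -/
theorem card_filter_rank_eq_one {α β : Type*} [LinearOrder β] (s : Finset α) (f : α → β)
    (hf : Function.Injective f) {v : ℕ} (hv : v < #s) :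
    #{k ∈ s | #{j ∈ s | f j < f k} = v} = 1 := by
  have rank_lt {k l : α} (hk : k ∈ s) (h : f k < f l) :
      #{j ∈ s | f j < f k} < #{j ∈ s | f j < f l} := by
    refine card_lt_card ((ssubset_iff_of_subset fun j hj => ?_).2 ⟨k, ?_, ?_⟩)
    · rw [mem_filter] at hj ⊢
      exact ⟨hj.1, hj.2.trans h⟩
    · simp [hk, h]
    · simp
  have inj : Set.InjOn (fun k => #{j ∈ s | f j < f k}) s := by
    intro k hk l hl h
    rcases lt_trichotomy (f k) (f l) with hlt | heq | hgt
    · exact absurd h (rank_lt hk hlt).ne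
    · exact hf heq
    · exact absurd h (rank_lt hl hgt).ne'
  have image_eq : s.image (fun k => #{j ∈ s | f j < f k}) = range #s := by
    refine eq_of_subset_of_card_le (fun r hr => ?_) (by rw [card_image_of_injOn inj, card_range])
    obtain ⟨k, hk, rfl⟩ := mem_image.1 hr
    exact mem_range.2 (card_lt_card (filter_ssubset.2 ⟨k, hk, lt_irrefl _⟩))
  obtain ⟨k, hk, hkv⟩ := mem_image.1 (image_eq ▸ mem_range.2 hv)
  refine card_eq_one.2 ⟨k, eq_singleton_iff_unique_mem.2 ⟨mem_filter.2 ⟨hk, hkv⟩, fun l hl => ?_⟩⟩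
  rw [mem_filter] at hl
  exact inj hl.1 hk (hl.2.trans hkv.symm)

/-- The number of permutations giving a point of `s` the rank `v` among the points of `s` does not
depend on the point. -/
theorem card_perm_rank_eq {α : Type*} [LinearOrder α] [Fintype α] (s : Finset α) {i k : α}
    (hi : i ∈ s) (hk : k ∈ s) (v : ℕ) :
    #{π : Equiv.Perm α | #{j ∈ s | π j < π k} = v} =
      #{π : Equiv.Perm α | #{j ∈ s | π j < π i} = v} := by
  have swap_mem (j : α) : Equiv.swap i k j ∈ s ↔ j ∈ s := by
    rcases eq_or_ne j i with rfl | hji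
    · simp [hi, hk]
    · rcases eq_or_ne j k with rfl | hjk
      · simp [hi, hk]
      · rw [Equiv.swap_apply_of_ne_of_ne hji hjk]
  refine card_equiv (Equiv.mulRight (Equiv.swap i k)) fun π => ?_
  have h : #{j ∈ s | π j < π k} = #{j ∈ s | (π * Equiv.swap i k) j < (π * Equiv.swap i k) i} :=
    card_equiv (Equiv.swap i k) fun j => by simp [swap_mem]
  simp [h]

/-- Step 5 of Section 3 (Lehmer): under the uniform distribution on permutations of
Fin n, each factoradic digit f(i) is uniform on {0,...,n-1-i}:
card{π | f_π(i) = v} · (n - i) = n!. -/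
theorem lehmer_digit_uniform (n : ℕ) (i : Fin n) (v : ℕ) (hv : v ≤ n - 1 - (i : ℕ)) :
    (Finset.univ.filter (fun π : Equiv.Perm (Fin n) =>
        (Finset.univ.filter (fun j : Fin n => i < j ∧ π j < π i)).card = v)).card
      * (n - (i : ℕ)) = Nat.factorial n := by
  have hcard : #(Ici i) = n - (i : ℕ) := Fin.card_Ici i
  have digit_eq (π : Equiv.Perm (Fin n)) :
      ({j | i < j ∧ π j < π i} : Finset (Fin n)) = {j ∈ Ici i | π j < π i} := by
    ext j
    simp only [mem_filter, mem_univ, true_and, mem_Ici]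
    refine ⟨fun h => ⟨h.1.le, h.2⟩, fun h => ⟨h.1.lt_of_ne ?_, h.2⟩⟩
    rintro rfl
    exact h.2.false
  simp only [digit_eq]
  calc _ = ∑ k ∈ Ici i, #{π : Equiv.Perm (Fin n) | #{j ∈ Ici i | π j < π k} = v} := by
        rw [sum_congr rfl fun k hk => card_perm_rank_eq (Ici i) (mem_Ici.2 le_rfl) hk v,
          sum_const, smul_eq_mul, hcard, mul_comm]
    _ = ∑ π : Equiv.Perm (Fin n), #{k ∈ Ici i | #{j ∈ Ici i | π j < π k} = v} :=
        sum_card_bipartiteAbove_eq_sum_card_bipartiteBelow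
          (fun k (π : Equiv.Perm (Fin n)) => #{j ∈ Ici i | π j < π k} = v)
    _ = ∑ _π : Equiv.Perm (Fin n), 1 :=
        sum_congr rfl fun π _ => card_filter_rank_eq_one _ π π.injective (by omega)
    _ = Nat.factorial n := by simp [Fintype.card_perm]
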